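/- arXiv:1607.08367 — 2 statements merged into one kernel-verified Lean document; each statement's English description precedes it below -/
import Mathlib

section
/- Let U ⊆ ℝⁿ be open, let f ∈ C²(U, ℝⁿ), η ∈ C²(U, ℝ) and q ∈ C¹(U, ℝ) be such that Dq(u) w = Dη(u)(Df(u) w) for every u ∈ U and w ∈ ℝⁿ (i.e. the covector field Dη Df has the potential q). Then for every u ∈ U the matrix identity (Df(u))ᵀ D²η(u) = D²η(u) Df(u) holds, where D²η(u) is the Hessian matrix of η at u. -/
open scoped BigOperators
open Matrix

/-- If `Dq = Dη ∘ Df` on an open set, the bilinear form `(v, w) ↦ D²η(u)(v, Df(u) w)` is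
symmetric. -/
theorem snd_fderiv_comp_fderiv_comm {E : Type*} [NormedAddCommGroup E] [NormedSpace ℝ E]
    {U : Set E} (hU : IsOpen U) {f : E → E} {η q : E → ℝ}
    (hf : ContDiffOn ℝ 2 f U) (hη : ContDiffOn ℝ 2 η U) (hq : DifferentiableOn ℝ q U)
    (hpot : ∀ u ∈ U, ∀ w : E, fderiv ℝ q u w = fderiv ℝ η u (fderiv ℝ f u w))
    {u : E} (hu : u ∈ U) (v w : E) :
    fderiv ℝ (fderiv ℝ η) u v (fderiv ℝ f u w) =
      fderiv ℝ (fderiv ℝ η) u w (fderiv ℝ f u v) := by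
  have hUu : U ∈ nhds u := hU.mem_nhds hu
  have hfu : ContDiffAt ℝ 2 f u := hf.contDiffAt hUu
  have hηu : ContDiffAt ℝ 2 η u := hη.contDiffAt hUu
  have hdf : HasFDerivAt (fderiv ℝ f) (fderiv ℝ (fderiv ℝ f) u) u :=
    ((hfu.fderiv_right (m := 1) (by norm_num)).differentiableAt (by norm_num)).hasFDerivAt
  have hdη : HasFDerivAt (fderiv ℝ η) (fderiv ℝ (fderiv ℝ η) u) u :=
    ((hηu.fderiv_right (m := 1) (by norm_num)).differentiableAt (by norm_num)).hasFDerivAt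
  have hdq : ∀ᶠ y in nhds u, HasFDerivAt q ((fderiv ℝ η y).comp (fderiv ℝ f y)) y := by
    filter_upwards [hUu] with y hy
    have hqy := (hq.differentiableAt (hU.mem_nhds hy)).hasFDerivAt
    rwa [show fderiv ℝ q y = (fderiv ℝ η y).comp (fderiv ℝ f y) from
      ContinuousLinearMap.ext (hpot y hy)] at hqy
  have hsymm := second_derivative_symmetric_of_eventually hdq (hdη.clm_comp hdf) v w
  have hfsymm : fderiv ℝ (fderiv ℝ f) u v w = fderiv ℝ (fderiv ℝ f) u w v :=
    hfu.isSymmSndFDerivAt (by simp) v w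
  simpa [hfsymm] using hsymm

/-- The commutation property `(Df(u))ᵀ D²η(u) = D²η(u) Df(u)` deduced from the
existence of an entropy flux `q` with `Dη Df = Dq`. -/
theorem commutation_property {n : ℕ} (U : Set (Fin n → ℝ)) (hU : IsOpen U)
    (f : (Fin n → ℝ) → (Fin n → ℝ)) (η : (Fin n → ℝ) → ℝ) (q : (Fin n → ℝ) → ℝ)
    (hf : ContDiffOn ℝ 2 f U) (hη : ContDiffOn ℝ 2 η U) (hq : ContDiffOn ℝ 1 q U)
    (hpot : ∀ u ∈ U, ∀ w : Fin n → ℝ,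
      fderiv ℝ q u w = fderiv ℝ η u (fderiv ℝ f u w))
    (u : Fin n → ℝ) (hu : u ∈ U) :
    (Matrix.of fun (i j : Fin n) =>
        fderiv ℝ (fun y => f y i) u (Pi.single j 1))ᵀ *
      (Matrix.of fun (i j : Fin n) =>
        fderiv ℝ (fun y => fderiv ℝ η y (Pi.single j 1)) u (Pi.single i 1)) =
    (Matrix.of fun (i j : Fin n) =>
        fderiv ℝ (fun y => fderiv ℝ η y (Pi.single j 1)) u (Pi.single i 1)) *
      (Matrix.of fun (i j : Fin n) =>
        fderiv ℝ (fun y => f y i) u (Pi.single j 1)) := by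
  have hUu : U ∈ nhds u := hU.mem_nhds hu
  have hfu : DifferentiableAt ℝ f u := (hf.contDiffAt hUu).differentiableAt (by norm_num)
  have hηu : ContDiffAt ℝ 2 η u := hη.contDiffAt hUu
  have hdη : DifferentiableAt ℝ (fderiv ℝ η) u :=
    (hηu.fderiv_right (m := 1) (by norm_num)).differentiableAt (by norm_num)
  have hηsymm (v w : Fin n → ℝ) :
      fderiv ℝ (fderiv ℝ η) u v w = fderiv ℝ (fderiv ℝ η) u w v :=
    hηu.isSymmSndFDerivAt (by simp) v w
  have hJ (i : Fin n) (v : Fin n → ℝ) : fderiv ℝ (fun y => f y i) u v = fderiv ℝ f u v i := by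
    rw [fderiv_apply hfu i]
    rfl
  have hH (v w : Fin n → ℝ) :
      fderiv ℝ (fun y => fderiv ℝ η y w) u v = fderiv ℝ (fderiv ℝ η) u v w := by
    rw [fderiv_clm_apply hdη (differentiableAt_const w)]
    simp
  have hsum (L : (Fin n → ℝ) →L[ℝ] ℝ) (v : Fin n → ℝ) :
      L v = ∑ k, v k * L (Pi.single k 1) := by
    have hsingle (k : Fin n) :
        (Pi.single k 1 : Fin n → ℝ) = fun j => if k = j then 1 else 0 := by
      ext j
      simp [Pi.single_apply, eq_comm]
    simpa [hsingle] using L.toLinearMap.pi_apply_eq_sum_univ v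
  ext i j
  simp only [Matrix.mul_apply, Matrix.transpose_apply, Matrix.of_apply, hJ, hH]
  have key := snd_fderiv_comp_fderiv_comm hU hf hη (hq.differentiableOn (by norm_num)) hpot hu
    (Pi.single j 1) (Pi.single i 1)
  rw [hsum _ (fderiv ℝ f u (Pi.single i 1)), hsum _ (fderiv ℝ f u (Pi.single j 1))] at key
  simpa only [hηsymm (Pi.single j 1), mul_comm] using key
end

section
/- Under the stated scalar setting, for every t ∈ [0,T] the following integral identity holds: ∫_Q [ (u − v̂) ∂_t(u − v̂) + ∇v̂ · ( f(u) − f(v̂) − f'(v̂)(u − v̂) ) + ε |∇(u − v̂)|² ] dx = ∫_Q [ (ε̂ − ε) ∇v̂ · ∇(u − v̂) − (R_H + div G)(u − v̂) ] dx, where all derivatives are spatial except ∂_t, and all functions are evaluated at time t. -/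
open scoped BigOperators
open MeasureTheory

/-- Spatial partial derivative in direction `α` of a scalar map. -/
noncomputable def pd {d : ℕ} (α : Fin d) (F : (Fin d → ℝ) → ℝ) (x : Fin d → ℝ) : ℝ :=
  fderiv ℝ F x (Pi.single α 1)

/-- The unit cube `[0,1)^d`, a fundamental domain of the torus `ℝ^d/ℤ^d`. -/
def unitCube (d : ℕ) : Set (Fin d → ℝ) := Set.univ.pi fun _ => Set.Ico (0 : ℝ) 1

/-- `ℤ^d`-periodicity of a map defined on `ℝ^d`. -/
def ZPeriodic {d : ℕ} {E : Type*} (F : (Fin d → ℝ) → E) : Prop :=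
  ∀ (x : Fin d → ℝ) (k : Fin d → ℤ), F (x + fun i => (k i : ℝ)) = F x

/-- The integral of the divergence of a periodic `C¹` vector field over the unit cube vanishes. -/
theorem integral_unitCube_sum_pd_eq_zero {d : ℕ} (H : Fin d → (Fin d → ℝ) → ℝ)
    (hH : ∀ α, ContDiff ℝ 1 (H α)) (hper : ∀ α, ZPeriodic (H α)) :
    ∫ x in unitCube d, ∑ α, pd α (H α) x = 0 := by
  cases d with
  | zero => simp
  | succ n =>
    have hcube : unitCube (n + 1) =ᵐ[volume] Set.Icc (0 : Fin (n + 1) → ℝ) 1 :=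
      Measure.univ_pi_Ico_ae_eq_Icc (μ := fun _ => (volume : Measure ℝ))
    rw [setIntegral_congr_set hcube]
    unfold pd
    rw [integral_divergence_of_hasFDerivAt_off_countable' 0 1 zero_le_one H
      (fun α x => fderiv ℝ (H α) x) ∅ Set.countable_empty
      (fun α => (hH α).continuous.continuousOn)
      (fun x _ α => ((hH α).differentiable one_ne_zero x).hasFDerivAt)]
    · refine Finset.sum_eq_zero fun α _ => sub_eq_zero.2 ?_
      refine integral_congr_ae (Filter.Eventually.of_forall fun x => ?_)
      have h := hper α (α.insertNth 0 x) (Pi.single α 1)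
      have hshift : (α.insertNth (0 : ℝ) x : Fin (n + 1) → ℝ)
          + (fun j => (((Pi.single α 1 : Fin (n + 1) → ℤ) j : ℤ) : ℝ)) = α.insertNth 1 x := by
        ext j
        refine Fin.succAboveCases α ?_ (fun k => ?_) j <;> simp
      rw [hshift] at h
      simpa using h
    · refine ContinuousOn.integrableOn_compact isCompact_Icc (Continuous.continuousOn ?_)
      exact continuous_finsetSum _ fun α _ =>
        ((hH α).continuous_fderiv one_ne_zero).clm_apply continuous_const

/-- A continuous function is integrable on the unit cube. -/
theorem Continuous.integrableOn_unitCube {d : ℕ} {F : (Fin d → ℝ) → ℝ} (hF : Continuous F) :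
    IntegrableOn F (unitCube d) :=
  (hF.continuousOn.integrableOn_compact
    (isCompact_Icc (a := (0 : Fin d → ℝ)) (b := 1))).mono_set fun _ hx =>
      ⟨fun i => (hx i trivial).1, fun i => (hx i trivial).2.le⟩

theorem ContDiff.continuous_pd {d : ℕ} {F : (Fin d → ℝ) → ℝ} (hF : ContDiff ℝ 1 F) (α : Fin d) :
    Continuous (pd α F) :=
  (hF.continuous_fderiv one_ne_zero).clm_apply continuous_const

theorem ContDiff.contDiff_pd {d : ℕ} {F : (Fin d → ℝ) → ℝ} (hF : ContDiff ℝ 2 F) (α : Fin d) :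
    ContDiff ℝ 1 (pd α F) :=
  (hF.fderiv_right (m := 1) (by norm_num)).clm_apply contDiff_const

theorem ZPeriodic.pd {d : ℕ} {F : (Fin d → ℝ) → ℝ} (hF : ZPeriodic F) (α : Fin d) :
    ZPeriodic (pd α F) := by
  intro x k
  have h : (fun y => F (y + fun i => (k i : ℝ))) = F := funext fun y => hF y k
  rw [_root_.pd, ← fderiv_comp_add_right, h, _root_.pd]

section PartialDerivative

variable {d : ℕ} {A B : (Fin d → ℝ) → ℝ} {x : Fin d → ℝ} (α : Fin d)

theorem pd_add (hA : DifferentiableAt ℝ A x) (hB : DifferentiableAt ℝ B x) :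
    pd α (fun y => A y + B y) x = pd α A x + pd α B x := by
  simp [pd, fderiv_fun_add hA hB]

theorem pd_sub (hA : DifferentiableAt ℝ A x) (hB : DifferentiableAt ℝ B x) :
    pd α (fun y => A y - B y) x = pd α A x - pd α B x := by
  simp [pd, fderiv_fun_sub hA hB]

theorem pd_mul (hA : DifferentiableAt ℝ A x) (hB : DifferentiableAt ℝ B x) :
    pd α (fun y => A y * B y) x = A x * pd α B x + pd α A x * B x := by
  simp [pd, fderiv_fun_mul hA hB, mul_comm (B x)]

theorem pd_const_mul (c : ℝ) (hA : DifferentiableAt ℝ A x) :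
    pd α (fun y => c * A y) x = c * pd α A x := by
  simp [pd, fderiv_const_mul hA]

theorem pd_comp {g : ℝ → ℝ} (hg : DifferentiableAt ℝ g (A x)) (hA : DifferentiableAt ℝ A x) :
    pd α (fun y => g (A y)) x = deriv g (A x) * pd α A x := by
  have h := hg.hasDerivAt.comp_hasFDerivAt x hA.hasFDerivAt
  have h' : fderiv ℝ (fun y => g (A y)) x = deriv g (A x) • fderiv ℝ A x := h.fderiv
  simp [pd, h']

end PartialDerivative

theorem exists_contDiff_primitive {g : ℝ → ℝ} (hg : Continuous g) :
    ∃ P : ℝ → ℝ, ContDiff ℝ 1 P ∧ deriv P = g := by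
  have h : ∀ s, HasDerivAt (fun r => ∫ z in (0 : ℝ)..r, g z) (g s) s := fun s =>
    intervalIntegral.integral_hasDerivAt_right (hg.intervalIntegrable _ _)
      (hg.stronglyMeasurableAtFilter _ _) hg.continuousAt
  have hd : deriv (fun r => ∫ z in (0 : ℝ)..r, g z) = g := funext fun s => (h s).deriv
  exact ⟨_, contDiff_one_iff_deriv.2 ⟨fun s => (h s).differentiableAt, by rwa [hd]⟩, hd⟩

/-- The basic integral identity obtained by testing the viscous conservation law and
the perturbed equation with `u − v̂` and subtracting. -/
theorem scalar_relative_entropy_identity {d : ℕ}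
    (f : ℝ → Fin d → ℝ) (hf : ContDiff ℝ 2 f)
    (ε T : ℝ) (hε : 0 < ε) (hT : 0 < T)
    (u ut vh vt εh RH : (Fin d → ℝ) → ℝ → ℝ)
    (G : (Fin d → ℝ) → ℝ → Fin d → ℝ)
    -- regularity and periodicity of u
    (hu_per : ∀ t ∈ Set.Icc 0 T, ZPeriodic fun x => u x t)
    (hu_space : ∀ t ∈ Set.Icc 0 T, ContDiff ℝ 2 fun x => u x t)
    (hu_time : ∀ x, ∀ t ∈ Set.Icc 0 T, HasDerivWithinAt (u x) (ut x t) (Set.Icc 0 T) t)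
    (hu_time' : ∀ x, ContinuousOn (ut x) (Set.Icc 0 T))
    -- u solves the viscous conservation law ∂ₜu + div f(u) = ε Δu
    (hu_pde : ∀ x, ∀ t ∈ Set.Icc 0 T,
      ut x t + ∑ α : Fin d, deriv (fun s => f s α) (u x t) * pd α (fun y => u y t) x
        = ε * ∑ α : Fin d, pd α (fun y => pd α (fun z => u z t) y) x)
    -- regularity and periodicity of v̂
    (hv_per : ∀ t ∈ Set.Icc 0 T, ZPeriodic fun x => vh x t)
    (hv_space : ∀ t ∈ Set.Icc 0 T, ContDiff ℝ 2 fun x => vh x t)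
    (hv_time : ∀ x, ∀ t ∈ Set.Icc 0 T, HasDerivWithinAt (vh x) (vt x t) (Set.Icc 0 T) t)
    (hv_time' : ∀ x, ContinuousOn (vt x) (Set.Icc 0 T))
    -- the model adaptation function ε̂ takes values in [0, ε], is C¹ and periodic in space
    (hεh_mem : ∀ x, ∀ t ∈ Set.Icc 0 T, εh x t ∈ Set.Icc 0 ε)
    (hεh_space : ∀ t ∈ Set.Icc 0 T, ContDiff ℝ 1 fun x => εh x t)
    (hεh_per : ∀ t ∈ Set.Icc 0 T, ZPeriodic fun x => εh x t)
    -- the residuals R_H and G = "R_P antiderivative" are regular and periodic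
    (hRH_cont : ContinuousOn (fun p : (Fin d → ℝ) × ℝ => RH p.1 p.2)
      (Set.univ ×ˢ Set.Icc 0 T))
    (hRH_per : ∀ t ∈ Set.Icc 0 T, ZPeriodic fun x => RH x t)
    (hG_space : ∀ t ∈ Set.Icc 0 T, ContDiff ℝ 1 fun x => G x t)
    (hG_per : ∀ t ∈ Set.Icc 0 T, ZPeriodic fun x => G x t)
    -- v̂ solves the perturbed equation ∂ₜv̂ + div f(v̂) = div(ε̂ ∇v̂) + R_H + div G
    (hv_pde : ∀ x, ∀ t ∈ Set.Icc 0 T,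
      vt x t + ∑ α : Fin d, deriv (fun s => f s α) (vh x t) * pd α (fun y => vh y t) x
        = (∑ α : Fin d, pd α (fun y => εh y t * pd α (fun z => vh z t) y) x)
          + RH x t + ∑ α : Fin d, pd α (fun y => G y t α) x) :
    ∀ t ∈ Set.Icc 0 T,
      (∫ x in unitCube d,
        ((u x t - vh x t) * (ut x t - vt x t)
          + (∑ α : Fin d, pd α (fun y => vh y t) x *
              (f (u x t) α - f (vh x t) α
                - deriv (fun s => f s α) (vh x t) * (u x t - vh x t)))
          + ε * ∑ α : Fin d, (pd α (fun y => u y t - vh y t) x) ^ 2))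
      = ∫ x in unitCube d,
          ((εh x t - ε) *
              (∑ α : Fin d,
                pd α (fun y => vh y t) x * pd α (fun y => u y t - vh y t) x)
            - (RH x t + ∑ α : Fin d, pd α (fun y => G y t α) x) * (u x t - vh x t)) := by
  intro t ht
  have hf' : ∀ α, ContDiff ℝ 2 fun s => f s α := fun α => contDiff_pi.1 hf α
  choose P hP hP' using fun α => exists_contDiff_primitive (hf' α).continuous
  have hu2 := hu_space t ht
  have hv2 := hv_space t ht
  have he := hεh_space t ht
  have hu : ContDiff ℝ 1 fun x => u x t := hu2.of_le one_le_two
  have hv : ContDiff ℝ 1 fun x => vh x t := hv2.of_le one_le_two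
  have hpu : ∀ α, ContDiff ℝ 1 (pd α fun x => u x t) := hu2.contDiff_pd
  have hpv : ∀ α, ContDiff ℝ 1 (pd α fun x => vh x t) := hv2.contDiff_pd
  have hG : ∀ α, ContDiff ℝ 1 fun x => G x t α := contDiff_pi.1 (hG_space t ht)
  have hR : Continuous fun x => RH x t :=
    hRH_cont.comp_continuous (f := fun x => (x, t)) (by fun_prop) fun x => ⟨trivial, ht⟩
  let visc : Fin d → (Fin d → ℝ) → ℝ := fun α y =>
    ε * pd α (fun z => u z t) y - εh y t * pd α (fun z => vh z t) y - f (u y t) α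
  let H : Fin d → (Fin d → ℝ) → ℝ := fun α y =>
    (u y t - vh y t) * visc α y + (P α (u y t) - P α (vh y t))
  have hfu : ∀ α, ContDiff ℝ 1 fun y => f (u y t) α := fun α =>
    ((hf' α).of_le one_le_two).comp hu
  have hPu : ∀ α, ContDiff ℝ 1 fun y => P α (u y t) := fun α => (hP α).comp hu
  have hPv : ∀ α, ContDiff ℝ 1 fun y => P α (vh y t) := fun α => (hP α).comp hv
  have hvisc : ∀ α, ContDiff ℝ 1 (visc α) := fun α =>
    ((contDiff_const.mul (hpu α)).sub (he.mul (hpv α))).sub (hfu α)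
  have hH : ∀ α, ContDiff ℝ 1 (H α) := fun α =>
    ((hu.sub hv).mul (hvisc α)).add ((hPu α).sub (hPv α))
  have hHper : ∀ α, ZPeriodic (H α) := by
    intro α x k
    have h1 := hu_per t ht x k
    have h2 := hv_per t ht x k
    have h3 := hεh_per t ht x k
    have h4 := (hu_per t ht).pd α x k
    have h5 := (hv_per t ht).pd α x k
    simp only at h1 h2 h3
    simp only [H, visc, h1, h2, h3, h4, h5]
  have hdiv := integral_unitCube_sum_pd_eq_zero H hH hHper
  have hpd : ∀ α x, pd α (H α) x =
      (u x t - vh x t) * (ε * pd α (pd α fun z => u z t) x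
        - pd α (fun y => εh y t * pd α (fun z => vh z t) y) x
        - deriv (fun s => f s α) (u x t) * pd α (fun z => u z t) x)
      + (pd α (fun z => u z t) x - pd α (fun z => vh z t) x)
        * (ε * pd α (fun z => u z t) x - εh x t * pd α (fun z => vh z t) x - f (u x t) α)
      + (f (u x t) α * pd α (fun z => u z t) x - f (vh x t) α * pd α (fun z => vh z t) x) := by
    intro α x
    have D : ∀ {A : (Fin d → ℝ) → ℝ}, ContDiff ℝ 1 A → DifferentiableAt ℝ A x :=
      fun h => h.differentiable one_ne_zero x
    have hPd : ∀ s, DifferentiableAt ℝ (P α) s := (hP α).differentiable one_ne_zero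
    rw [pd_add α (D ((hu.sub hv).mul (hvisc α))) (D ((hPu α).sub (hPv α))),
      pd_mul α (D (hu.sub hv)) (D (hvisc α)), pd_sub α (D hu) (D hv),
      pd_sub α (D (hPu α)) (D (hPv α)), pd_comp α (hPd _) (D hu), pd_comp α (hPd _) (D hv), hP',
      pd_sub α (D ((contDiff_const.mul (hpu α)).sub (he.mul (hpv α)))) (D (hfu α)),
      pd_sub α (D (contDiff_const.mul (hpu α))) (D (he.mul (hpv α))),
      pd_const_mul α ε (D (hpu α)),
      pd_comp (g := fun s => f s α) α ((hf' α).differentiable two_ne_zero _) (D hu)]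
  have hpw : ∀ α x, pd α (fun y => u y t - vh y t) x
      = pd α (fun z => u z t) x - pd α (fun z => vh z t) x := fun α x =>
    pd_sub α (hu.differentiable one_ne_zero x) (hv.differentiable one_ne_zero x)
  have hrhs : Continuous fun x => (εh x t - ε) *
        (∑ α : Fin d, pd α (fun y => vh y t) x * pd α (fun y => u y t - vh y t) x)
      - (RH x t + ∑ α : Fin d, pd α (fun y => G y t α) x) * (u x t - vh x t) := by
    have c1 := fun α => (hpv α).continuous
    have c2 : ∀ α, Continuous (pd α fun y => u y t - vh y t) := (hu.sub hv).continuous_pd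
    have c3 := fun α => (hG α).continuous_pd α
    have c4 := he.continuous
    have c5 := hu.continuous
    have c6 := hv.continuous
    fun_prop
  have hdivc : Continuous fun x => ∑ α, pd α (H α) x :=
    continuous_finsetSum _ fun α _ => (hH α).continuous_pd α
  rw [← add_zero (∫ x in unitCube d, _ - _), ← hdiv,
    ← integral_add hrhs.integrableOn_unitCube hdivc.integrableOn_unitCube]
  congr 1
  ext x
  have hut := eq_sub_of_add_eq (hu_pde x t ht)
  have hvt := eq_sub_of_add_eq (hv_pde x t ht)
  have hsum : ∑ α, pd α (H α) x =
      (u x t - vh x t) * (ε * ∑ α, pd α (fun y => pd α (fun z => u z t) y) x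
        - ∑ α, pd α (fun y => εh y t * pd α (fun z => vh z t) y) x
        - ∑ α, deriv (fun s => f s α) (u x t) * pd α (fun y => u y t) x
        + ∑ α, deriv (fun s => f s α) (vh x t) * pd α (fun y => vh y t) x)
      + (∑ α, pd α (fun y => vh y t) x * (f (u x t) α - f (vh x t) α
          - deriv (fun s => f s α) (vh x t) * (u x t - vh x t)))
      + ε * (∑ α, pd α (fun y => u y t - vh y t) x ^ 2)
      - (εh x t - ε) *
        (∑ α, pd α (fun y => vh y t) x * pd α (fun y => u y t - vh y t) x) := by
    simp only [Finset.mul_sum, ← Finset.sum_add_distrib, ← Finset.sum_sub_distrib]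
    refine Finset.sum_congr rfl fun α _ => ?_
    rw [hpd, hpw]
    ring
  rw [hsum, hut, hvt]
  ring
end
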